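/- Let n > 1 be an integer all of whose prime divisors p satisfy that the multiplicative order of 2 modulo p is congruent to 2 modulo 4, and let μ be the multiplicative order of 2 modulo n. Then the pairs {2^{2i} mod n, 2^{2i+1} mod n}, for 0 ≤ i ≤ (μ−2)/2, form a partition of the cyclic subgroup ⟨2⟩ generated by 2 in the group of units of ℤ_n, and the set {±2^{2i} mod n : 0 ≤ i ≤ (μ−2)/2} equals ⟨2⟩. -/

import Mathlib

/-- If an odd prime `p` and an integer `a` both divide `x + 1`, then `p * a` divides `x ^ p + 1`. -/
theorem Int.prime_mul_dvd_pow_add_one {p : ℕ} (hp : Odd p) {a x : ℤ}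
    (hpx : (p : ℤ) ∣ x + 1) (hax : a ∣ x + 1) : (p : ℤ) * a ∣ x ^ p + 1 := by
  have hsum : (p : ℤ) ∣ ∑ i ∈ Finset.range p, (-x) ^ i := by
    have hx : ((-x : ℤ) : ZMod p) = 1 := by
      have h0 := (ZMod.intCast_zmod_eq_zero_iff_dvd (x + 1) p).2 hpx
      push_cast at h0 ⊢
      linear_combination -h0
    rw [← ZMod.intCast_zmod_eq_zero_iff_dvd, Int.cast_sum]
    simp only [Int.cast_pow, hx]
    simp
  have hfac : x ^ p + 1 = (∑ i ∈ Finset.range p, (-x) ^ i) * (x + 1) := by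
    have hg := geom_sum_mul (-x) p
    rw [hp.neg_pow] at hg
    linear_combination hg
  rw [hfac]
  exact mul_dvd_mul hsum hax

/-- A divisor of `x + 1` divides `x ^ m + 1` for odd `m`. -/
theorem Int.dvd_pow_add_one_of_odd {a x : ℤ} {m : ℕ} (hm : Odd m) (h : a ∣ x + 1) :
    a ∣ x ^ m + 1 := by
  simpa using h.trans (hm.add_dvd_pow_add_pow x 1)

/-- If `2` has order `≡ 2 (mod 4)` modulo a prime `p`, then some odd power of `2` is `-1`
modulo `p`. -/
theorem ZMod.exists_odd_two_pow_add_one_of_prime {p : ℕ} (hp : p.Prime)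
    (h : orderOf (2 : ZMod p) % 4 = 2) : ∃ m : ℕ, Odd m ∧ (p : ℤ) ∣ 2 ^ m + 1 := by
  have : Fact p.Prime := ⟨hp⟩
  obtain ⟨m, hm⟩ : ∃ m, orderOf (2 : ZMod p) = 2 * m :=
    ⟨orderOf (2 : ZMod p) / 2, by omega⟩
  refine ⟨m, Nat.odd_iff.2 (by omega), ?_⟩
  have hsq : ((2 : ZMod p) ^ m) ^ 2 = 1 := by
    rw [← pow_mul, mul_comm, ← hm, pow_orderOf_eq_one]
  have hne : (2 : ZMod p) ^ m ≠ 1 := fun h1 ↦ by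
    have := Nat.le_of_dvd (by omega) (orderOf_dvd_of_pow_eq_one h1)
    omega
  have hneg := (mul_self_eq_one_iff.1 ((sq _).symm.trans hsq)).resolve_left hne
  rw [← ZMod.intCast_zmod_eq_zero_iff_dvd]
  push_cast
  rw [hneg]
  ring

/-- If `2` has order `≡ 2 (mod 4)` modulo every prime divisor of `n`, then `n` divides `2 ^ m + 1`
for some odd `m`. -/
theorem exists_odd_dvd_two_pow_add_one {n : ℕ} (hn : n ≠ 0)
    (h : ∀ p : ℕ, p.Prime → p ∣ n → orderOf (2 : ZMod p) % 4 = 2) :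
    ∃ m : ℕ, Odd m ∧ (n : ℤ) ∣ 2 ^ m + 1 := by
  induction n using induction_on_primes with
  | zero => exact absurd rfl hn
  | one => exact ⟨1, odd_one, by simp⟩
  | prime_mul p a hp ih =>
    obtain ⟨m, hm, hma⟩ := ih (right_ne_zero_of_mul hn)
      fun q hq hqa ↦ h q hq (hqa.mul_left p)
    obtain ⟨k, hk, hkp⟩ :=
      ZMod.exists_odd_two_pow_add_one_of_prime hp (h p hp (dvd_mul_right p a))
    have hodd : Odd p := by
      refine hp.odd_of_ne_two ?_
      rintro rfl
      have hk0 : k ≠ 0 := hk.pos.ne'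
      have : (2 : ℤ) ∣ 2 ^ k := dvd_pow_self 2 hk0
      have h2 : (2 : ℤ) ∣ 2 ^ k + 1 := by exact_mod_cast hkp
      omega
    refine ⟨m * k * p, (hm.mul hk).mul hodd, ?_⟩
    rw [Nat.cast_mul, pow_mul]
    refine Int.prime_mul_dvd_pow_add_one hodd ?_ ?_
    · rw [mul_comm m k, pow_mul]
      exact Int.dvd_pow_add_one_of_odd hm hkp
    · rw [pow_mul]
      exact Int.dvd_pow_add_one_of_odd hk hma

/-- If an odd power of `x` is `-1 ≠ 1`, then the order of `x` is `2 * t` with `t` odd and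
`x ^ t = -1`. -/
theorem exists_odd_orderOf_eq_two_mul {R : Type*} [Ring R] (h1 : (-1 : R) ≠ 1) {x : R} {m : ℕ}
    (hm : Odd m) (hx : x ^ m = -1) : ∃ t : ℕ, Odd t ∧ orderOf x = 2 * t ∧ x ^ t = -1 := by
  have hdvd : orderOf x ∣ 2 * m := orderOf_dvd_of_pow_eq_one (by
    rw [mul_comm, pow_mul, hx, neg_one_sq])
  have heven : Even (orderOf x) := by
    by_contra hodd
    have hcop : Nat.Coprime (orderOf x) 2 :=
      (Nat.coprime_two_right).2 (Nat.not_even_iff_odd.1 hodd)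
    exact h1 (hx ▸ orderOf_dvd_iff_pow_eq_one.1 (hcop.dvd_of_dvd_mul_left hdvd))
  obtain ⟨t, ht⟩ := heven.two_dvd
  rw [ht] at hdvd
  obtain ⟨s, rfl⟩ := Nat.dvd_of_mul_dvd_mul_left two_pos hdvd
  obtain ⟨hto, hso⟩ := Nat.odd_mul.1 hm
  refine ⟨t, hto, ht, ?_⟩
  obtain ⟨r, rfl⟩ := hso
  rw [← hx, mul_add, mul_one, pow_add, ← mul_assoc, mul_comm t 2, pow_mul, ← ht,
    pow_orderOf_eq_one, one_pow, one_mul]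


/-- Let `n > 1` be an integer all of whose prime divisors `p` satisfy
`ord_p(2) ≡ 2 (mod 4)`, and let `μ = ord_n(2)`. Then the pairs
`{2^(2i), 2^(2i+1)}`, `0 ≤ i ≤ (μ-2)/2`, form a partition of the cyclic
subgroup `⟨2⟩` of the unit group of `ZMod n` (viewed as the set of powers of `2`),
and `{± 2^(2i) : 0 ≤ i ≤ (μ-2)/2} = ⟨2⟩`. -/
theorem powers_of_two_cardioidal_partition (n : ℕ) (hn : 1 < n)
    (h : ∀ p : ℕ, p.Prime → p ∣ n → orderOf (2 : ZMod p) % 4 = 2)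
    (μ : ℕ) (hμ : μ = orderOf (2 : ZMod n)) :
    ((∀ i ∈ Finset.Icc 0 ((μ - 2) / 2),
        (2 : ZMod n) ^ (2 * i) ≠ (2 : ZMod n) ^ (2 * i + 1)) ∧
      (∀ x : ZMod n, (∃ k : ℕ, (2 : ZMod n) ^ k = x) →
        ∃! i, i ∈ Finset.Icc 0 ((μ - 2) / 2) ∧
          (x = (2 : ZMod n) ^ (2 * i) ∨ x = (2 : ZMod n) ^ (2 * i + 1)))) ∧
    {x : ZMod n | ∃ i, i ≤ (μ - 2) / 2 ∧
        (x = (2 : ZMod n) ^ (2 * i) ∨ x = -((2 : ZMod n) ^ (2 * i)))} =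
      {x : ZMod n | ∃ k : ℕ, (2 : ZMod n) ^ k = x} := by
  obtain ⟨m, hm, hdvd⟩ := exists_odd_dvd_two_pow_add_one (by omega) h
  have hpow : (2 : ZMod n) ^ m = -1 := by
    have h0 := (ZMod.intCast_zmod_eq_zero_iff_dvd _ n).2 hdvd
    push_cast at h0
    linear_combination h0
  have hn2 : 2 < n := by
    refine lt_of_le_of_ne hn ?_
    rintro rfl
    have h2 := h 2 Nat.prime_two dvd_rfl
    rw [show (2 : ZMod 2) = 0 from rfl, orderOf_zero] at h2
    omega
  have : Fact (2 < n) := ⟨hn2⟩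
  obtain ⟨t, hto, hord, ht⟩ := exists_odd_orderOf_eq_two_mul ZMod.neg_one_ne_one hm hpow
  have htpos := hto.pos
  rw [hord] at hμ
  subst hμ
  have hunit : IsUnit (2 : ZMod n) :=
    IsUnit.of_pow_eq_one (hord ▸ pow_orderOf_eq_one (2 : ZMod n)) (by omega)
  have hinj (a b : ℕ) : (2 : ZMod n) ^ a = 2 ^ b ↔ a % (2 * t) = b % (2 * t) := by
    obtain ⟨u, hu⟩ := hunit
    rw [← hord, ← hu, orderOf_units, ← pow_inj_mod, ← Units.val_pow_eq_pow_val,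
      ← Units.val_pow_eq_pow_val, Units.val_inj]
  have hmod {a : ℕ} (ha : a < 2 * t) : a % (2 * t) = a := Nat.mod_eq_of_lt ha
  refine ⟨⟨fun i hi ↦ ?_, ?_⟩, ?_⟩
  · rw [Finset.mem_Icc] at hi
    rw [Ne, hinj, hmod (by omega), hmod (by omega)]
    omega
  · rintro _ ⟨k, rfl⟩
    have hk : k % (2 * t) < 2 * t := Nat.mod_lt _ (by omega)
    refine ⟨k % (2 * t) / 2, ⟨Finset.mem_Icc.2 (by omega), ?_⟩, ?_⟩
    · rw [hinj, hinj, hmod (a := 2 * (k % (2 * t) / 2)) (by omega),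
        hmod (a := 2 * (k % (2 * t) / 2) + 1) (by omega)]
      omega
    · rintro i ⟨hi, hki⟩
      rw [Finset.mem_Icc] at hi
      rw [hinj, hinj, hmod (a := 2 * i) (by omega), hmod (a := 2 * i + 1) (by omega)] at hki
      omega
  · have heven {k : ℕ} (hk : Even k) :
        ∃ i, i ≤ (2 * t - 2) / 2 ∧ (2 : ZMod n) ^ k = 2 ^ (2 * i) := by
      have hlt : k % (2 * t) < 2 * t := Nat.mod_lt _ (by omega)
      have hpar : k % (2 * t) % 2 = 0 := by
        rw [Nat.mod_mul_right_mod, Nat.even_iff.1 hk]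
      refine ⟨k % (2 * t) / 2, by omega, ?_⟩
      rw [hinj, hmod (a := 2 * (k % (2 * t) / 2)) (by omega)]
      omega
    ext x
    constructor
    · rintro ⟨i, -, rfl | rfl⟩
      · exact ⟨2 * i, rfl⟩
      · exact ⟨2 * i + t, by rw [pow_add, ht, mul_neg_one]⟩
    · rintro ⟨k, rfl⟩
      rcases Nat.even_or_odd k with hk | hk
      · obtain ⟨i, hi, hki⟩ := heven hk
        exact ⟨i, hi, Or.inl hki⟩
      · obtain ⟨i, hi, hki⟩ := heven (hk.add_odd hto)
        refine ⟨i, hi, Or.inr ?_⟩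
        rw [← hki, pow_add, ht, mul_neg_one, neg_neg]
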